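/- Let Φ be a quantum channel on I = (a × b) ⊕ k. Then subsystem B is noiseless for Φ if and only if Tr_A ∘ 𝒫 ∘ Φ ∘ 𝒫 = Tr_A ∘ 𝒫 as maps from I×I matrices to b×b matrices. -/

import Mathlib

open Matrix Kronecker BigOperators

section

variable {a b k : Type*} [Fintype a] [Fintype b] [Fintype k]
  [DecidableEq a] [DecidableEq b] [DecidableEq k]

/-- The embedding of `σA ⊗ σB` into the `(a × b) ⊕ k`-indexed matrices:
the entry at `((x,i),(y,j))` (both in the `a × b` summand) is
`σA x y * σB i j`, and all other entries vanish. -/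
noncomputable def emb (σA : Matrix a a ℂ) (σB : Matrix b b ℂ) :
    Matrix ((a × b) ⊕ k) ((a × b) ⊕ k) ℂ :=
  Matrix.fromBlocks (σA ⊗ₖ σB) 0 0 0

/-- The projection onto the `a × b` summand. -/
noncomputable def Pm : Matrix ((a × b) ⊕ k) ((a × b) ⊕ k) ℂ :=
  Matrix.fromBlocks 1 0 0 0

/-- The partial trace over the `A` subsystem. -/
noncomputable def trA (M : Matrix ((a × b) ⊕ k) ((a × b) ⊕ k) ℂ) :
    Matrix b b ℂ :=
  fun i j => ∑ x : a, M (Sum.inl (x, i)) (Sum.inl (x, j))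

theorem aux_Pm (ρ : Matrix ((a × b) ⊕ k) ((a × b) ⊕ k) ℂ) :
    Pm * ρ * Pm = Matrix.fromBlocks ρ.toBlocks₁₁ 0 0 0 := by
  conv_lhs => rw [← Matrix.fromBlocks_toBlocks ρ]
  simp [Pm, Matrix.fromBlocks_multiply]

theorem aux_trA (ρ : Matrix ((a × b) ⊕ k) ((a × b) ⊕ k) ℂ) :
    trA (Pm * ρ * Pm) = trA ρ := by
  rw [aux_Pm]
  rfl

theorem aux_trA_emb (σA : Matrix a a ℂ) (σB : Matrix b b ℂ) :
    trA (emb σA σB : Matrix ((a × b) ⊕ k) ((a × b) ⊕ k) ℂ) = σA.trace • σB := by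
  ext i j
  simp [trA, emb, Matrix.trace, Finset.sum_mul]

theorem aux_trace_emb (σA : Matrix a a ℂ) (σB : Matrix b b ℂ) :
    (emb σA σB : Matrix ((a × b) ⊕ k) ((a × b) ⊕ k) ℂ).trace = σA.trace * σB.trace := by
  rw [← Matrix.trace_kronecker]
  simp [emb, Matrix.trace]

theorem aux_trA_add (M N : Matrix ((a × b) ⊕ k) ((a × b) ⊕ k) ℂ) :
    trA (M + N) = trA M + trA N := by
  ext i j
  simp [trA, Finset.sum_add_distrib]

theorem aux_emb_add (σA : Matrix a a ℂ) (σB τB : Matrix b b ℂ) :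
    (emb σA (σB + τB) : Matrix ((a × b) ⊕ k) ((a × b) ⊕ k) ℂ) = emb σA σB + emb σA τB := by
  simp [emb, Matrix.kronecker_add, Matrix.fromBlocks_add]

theorem aux_single (E : Matrix ((a × b) ⊕ k) ((a × b) ⊕ k) ℂ) (p q r s : (a × b) ⊕ k) :
    (E * (Matrix.single p q 1 : Matrix ((a × b) ⊕ k) ((a × b) ⊕ k) ℂ) * Eᴴ) r s = E r p * star (E s q) := by
  rw [Matrix.mul_apply, Finset.sum_eq_single q]
  · simp
  · intro t _ ht
    simp [Matrix.mul_single_apply_of_ne _ _ _ _ _ ht]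
  · simp

theorem aux_forward [Nonempty b]
    (Φ : Matrix ((a × b) ⊕ k) ((a × b) ⊕ k) ℂ → Matrix ((a × b) ⊕ k) ((a × b) ⊕ k) ℂ)
    (hadd : ∀ ρ τ, Φ (ρ + τ) = Φ ρ + Φ τ)
    (htr : ∀ ρ, (Φ ρ).trace = ρ.trace)
    (h : ∀ (σA : Matrix a a ℂ) (σB : Matrix b b ℂ),
        ∃ τA : Matrix a a ℂ, Φ (emb σA σB) = emb τA σB)
    (ρ : Matrix ((a × b) ⊕ k) ((a × b) ⊕ k) ℂ) :
    trA (Pm * Φ (Pm * ρ * Pm) * Pm) = trA (Pm * ρ * Pm) := by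
  have h1 : ∀ (σA : Matrix a a ℂ) (σB : Matrix b b ℂ), σB.trace ≠ 0 →
      trA (Φ (emb σA σB)) = σA.trace • σB := by
    intro σA σB hB
    obtain ⟨τA, hτ⟩ := h σA σB
    have := htr (emb σA σB)
    rw [hτ, aux_trace_emb, aux_trace_emb] at this
    rw [hτ, aux_trA_emb, mul_right_cancel₀ hB this]
  have h2 : ∀ (σA : Matrix a a ℂ) (σB : Matrix b b ℂ),
      trA (Φ (emb σA σB)) = σA.trace • σB := by
    intro σA σB
    by_cases hB : σB.trace = 0
    · have h1b : (1 : Matrix b b ℂ).trace ≠ 0 := by simp [Matrix.trace_one]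
      have e1 := h1 σA 1 h1b
      have e2 := h1 σA (σB + 1) (by rw [Matrix.trace_add, hB, zero_add]; exact h1b)
      rw [aux_emb_add, hadd, aux_trA_add, e1, smul_add] at e2
      exact add_right_cancel e2
    · exact h1 σA σB hB
  rw [aux_trA, aux_Pm]
  generalize ρ.toBlocks₁₁ = M
  have h0 : Φ 0 = 0 := by
    have := hadd 0 0
    simpa using this
  induction M using Matrix.induction_on' with
  | h_zero => rw [Matrix.fromBlocks_zero, h0]
  | h_add M N hM hN =>
    have : (Matrix.fromBlocks (M + N) 0 0 0 : Matrix ((a × b) ⊕ k) ((a × b) ⊕ k) ℂ)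
        = Matrix.fromBlocks M 0 0 0 + Matrix.fromBlocks N 0 0 0 := by
      simp [Matrix.fromBlocks_add]
    rw [this, hadd, aux_trA_add, aux_trA_add, hM, hN]
  | h_std_basis p q z =>
    obtain ⟨x, i⟩ := p
    obtain ⟨y, j⟩ := q
    have : (Matrix.fromBlocks (Matrix.single (x, i) (y, j) z) 0 0 0 :
        Matrix ((a × b) ⊕ k) ((a × b) ⊕ k) ℂ)
        = emb (Matrix.single x y z) (Matrix.single i j 1) := by
      rw [emb, Matrix.single_kronecker_single, mul_one]
    rw [this, h2, aux_trA_emb]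

open scoped ComplexOrder in
theorem aux_sq_zero {ι : Type*} [Fintype ι] (f : ι → ℂ) (h : ∑ c, f c * star (f c) = 0) (c : ι) :
    f c = 0 := by
  have h' : f ⬝ᵥ star f = 0 := h
  rw [dotProduct_comm, dotProduct_star_self_eq_zero] at h'
  exact congrFun h' c

theorem aux_backward [Nonempty b]
    {C : Type*} [Fintype C]
    (E : C → Matrix ((a × b) ⊕ k) ((a × b) ⊕ k) ℂ)
    (hE : ∑ c, (E c)ᴴ * E c = 1)
    (h : ∀ ρ : Matrix ((a × b) ⊕ k) ((a × b) ⊕ k) ℂ,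
        trA (Pm * (∑ c, E c * (Pm * ρ * Pm) * (E c)ᴴ) * Pm) = trA (Pm * ρ * Pm)) :
    ∃ A : C → Matrix a a ℂ, (∀ c x i y j, E c (Sum.inl (x, i)) (Sum.inl (y, j))
        = if i = j then A c x y else 0) ∧
      ∀ c z p, E c (Sum.inr z) (Sum.inl p) = 0 := by
  have H : ∀ (y : a) (j : b) (y' : a) (j' i i' : b),
      ∑ cx : C × a, E cx.1 (Sum.inl (cx.2, i)) (Sum.inl (y, j)) *
        star (E cx.1 (Sum.inl (cx.2, i')) (Sum.inl (y', j')))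
      = if y = y' ∧ i = j ∧ i' = j' then 1 else 0 := by
    intro y j y' j' i i'
    have h1 := h (Matrix.single (Sum.inl (y, j)) (Sum.inl (y', j')) 1)
    have h2 : Pm * (Matrix.single (Sum.inl (y, j)) (Sum.inl (y', j')) 1) * Pm
        = (Matrix.single (Sum.inl (y, j)) (Sum.inl (y', j')) 1 :
          Matrix ((a × b) ⊕ k) ((a × b) ⊕ k) ℂ) := by
      rw [aux_Pm]
      ext (p | p) (q | q) <;> simp [Matrix.toBlocks₁₁, Matrix.single_apply]
    rw [aux_trA, h2] at h1
    have h3 := congrFun (congrFun h1 i) i'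
    simp only [trA, Matrix.sum_apply, aux_single] at h3
    rw [Fintype.sum_prod_type, Finset.sum_comm]
    refine h3.trans ?_
    simp only [Matrix.single_apply, Sum.inl.injEq, Prod.mk.injEq]
    by_cases hy : y = y'
    · subst hy
      by_cases hi : j = i <;> by_cases hi' : j' = i' <;>
        simp [hi, hi', eq_comm (a := i), eq_comm (a := i')]
    · rw [if_neg (by tauto)]
      apply Finset.sum_eq_zero
      intro x _
      rw [if_neg]
      rintro ⟨⟨rfl, _⟩, ⟨rfl, _⟩⟩
      exact hy rfl
  have hoff : ∀ c x i y j, i ≠ j → E c (Sum.inl (x, i)) (Sum.inl (y, j)) = 0 := by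
    intro c x i y j hij
    refine aux_sq_zero (fun cx : C × a => E cx.1 (Sum.inl (cx.2, i)) (Sum.inl (y, j))) ?_ (c, x)
    rw [H, if_neg (by tauto)]
  have hdiag : ∀ c x i y j, E c (Sum.inl (x, i)) (Sum.inl (y, i))
      = E c (Sum.inl (x, j)) (Sum.inl (y, j)) := by
    intro c x i y j
    rw [← sub_eq_zero]
    refine aux_sq_zero (fun cx : C × a => E cx.1 (Sum.inl (cx.2, i)) (Sum.inl (y, i))
      - E cx.1 (Sum.inl (cx.2, j)) (Sum.inl (y, j))) ?_ (c, x)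
    simp only [star_sub, sub_mul, mul_sub, Finset.sum_sub_distrib, H]
    simp
  refine ⟨fun c x y => E c (Sum.inl (x, Classical.arbitrary b))
    (Sum.inl (y, Classical.arbitrary b)), ?_, ?_⟩
  · intro c x i y j
    split_ifs with hij
    · subst hij
      exact hdiag _ _ _ _ _
    · exact hoff _ _ _ _ _ hij
  · rintro c z ⟨y, j⟩
    refine aux_sq_zero (fun cz : C × k => E cz.1 (Sum.inr cz.2) (Sum.inl (y, j))) ?_ (c, z)
    have h1 := congrFun (congrFun hE (Sum.inl (y, j))) (Sum.inl (y, j))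
    simp only [Matrix.sum_apply, Matrix.mul_apply, Fintype.sum_sum_type, Matrix.conjTranspose_apply,
      Matrix.one_apply_eq, Finset.sum_add_distrib] at h1
    have h2 : ∑ c, ∑ p : a × b, star (E c (Sum.inl p) (Sum.inl (y, j))) *
        E c (Sum.inl p) (Sum.inl (y, j)) = 1 := by
      have h3 := H y j y j j j
      rw [if_pos (by simp), Fintype.sum_prod_type] at h3
      rw [← h3]
      refine Finset.sum_congr rfl fun c _ => ?_
      rw [Fintype.sum_prod_type]
      refine Finset.sum_congr rfl fun x _ => ?_
      rw [Finset.sum_eq_single j]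
      · exact mul_comm _ _
      · intro i _ hi
        rw [hoff _ _ _ _ _ hi, mul_zero]
      · simp
    rw [h2] at h1
    rw [Fintype.sum_prod_type]
    simp only [mul_comm _ (star _)]
    exact left_eq_add.mp h1.symm

/-- For a quantum channel `Φ` on `I = (a × b) ⊕ k`, subsystem
`B` is noiseless for `Φ` iff `Tr_A ∘ 𝒫 ∘ Φ ∘ 𝒫 = Tr_A ∘ 𝒫` where `𝒫(ρ) = PρP`. -/
theorem noiseless_iff_traceA_compression
    {C : Type*} [Fintype C] [Nonempty a] [Nonempty b] [Nonempty k]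
    (Φ : Matrix ((a × b) ⊕ k) ((a × b) ⊕ k) ℂ →
         Matrix ((a × b) ⊕ k) ((a × b) ⊕ k) ℂ)
    (E : C → Matrix ((a × b) ⊕ k) ((a × b) ⊕ k) ℂ)
    (hΦ : ∀ ρ, Φ ρ = ∑ c, E c * ρ * (E c)ᴴ)
    (hE : ∑ c, (E c)ᴴ * E c = 1) :
    (∀ (σA : Matrix a a ℂ) (σB : Matrix b b ℂ),
        ∃ τA : Matrix a a ℂ, Φ (emb σA σB) = emb τA σB) ↔
    (∀ ρ : Matrix ((a × b) ⊕ k) ((a × b) ⊕ k) ℂ,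
        trA (Pm * Φ (Pm * ρ * Pm) * Pm) = trA (Pm * ρ * Pm)) := by
  constructor
  · intro h
    refine aux_forward Φ ?_ ?_ h
    · intro ρ τ
      simp only [hΦ, mul_add, add_mul, Finset.sum_add_distrib]
    · intro ρ
      rw [hΦ, Matrix.trace_sum]
      simp only [fun c => Matrix.trace_mul_cycle (E c) ρ (E c)ᴴ]
      rw [← Matrix.trace_sum, ← Finset.sum_mul, hE, one_mul]
  · intro h σA σB
    simp only [hΦ] at h
    obtain ⟨A, hA, hY⟩ := aux_backward E hE h
    refine ⟨∑ c, A c * σA * (A c)ᴴ, ?_⟩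
    have hX : ∀ c, E c = Matrix.fromBlocks (A c ⊗ₖ 1) (E c).toBlocks₁₂ 0 (E c).toBlocks₂₂ := by
      intro c
      ext (⟨x, i⟩ | z) (⟨y, j⟩ | w)
      · simp [hA, Matrix.one_apply]
      · rfl
      · simp [hY]
      · rfl
    have hc : ∀ c, E c * emb σA σB * (E c)ᴴ = emb (A c * σA * (A c)ᴴ) σB := by
      intro c
      rw [hX c]
      simp [emb, Matrix.fromBlocks_multiply, Matrix.fromBlocks_conjTranspose,
        Matrix.conjTranspose_kronecker, ← Matrix.mul_kronecker_mul]
    rw [hΦ]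
    simp only [hc]
    ext (⟨x, i⟩ | z) (⟨y, j⟩ | w) <;> simp [emb, Matrix.sum_apply, Finset.sum_mul]

end
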